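/- Let D, D′ ⊆ 2^[n] be domains such that every X ∈ D is weakly separated from every Y ∈ D′ (a complementary pair). If the domain D ∪ D′ is w-pure, then both D and D′ are w-pure. -/

import Mathlib

open Finset

/-- max of a finite set of naturals, with the convention `max0 ∅ = 0`. -/
def max0 (A : Finset ℕ) : ℕ := if h : A.Nonempty then A.max' h else 0

/-- min of a finite set of naturals, with the convention `min0 ∅ = 0`. -/
def min0 (A : Finset ℕ) : ℕ := if h : A.Nonempty then A.min' h else 0

/-- `A < B` : global dominating, i.e. `max A < min B` (with `min ∅ = max ∅ = 0`). -/
def SetLT (A B : Finset ℕ) : Prop := max0 A < min0 B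

/-- `A ⋖ B` : global dominating after cancelations, i.e. `(A − B) < (B − A)`. -/
def LessDot (A B : Finset ℕ) : Prop := SetLT (A \ B) (B \ A)

/-- `A ▷ B` (splitting): `A − B ≠ ∅` and `B − A` is a union of nonempty subsets
`B′, B″` with `B′ < (A − B) < B″`. -/
def Splits (A B : Finset ℕ) : Prop :=
  (A \ B).Nonempty ∧ ∃ B' B'' : Finset ℕ, B'.Nonempty ∧ B''.Nonempty ∧
    B' ∪ B'' = B \ A ∧ SetLT B' (A \ B) ∧ SetLT (A \ B) B''

/-- `A` and `B` are strongly separated. -/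
def StronglySep (A B : Finset ℕ) : Prop := LessDot A B ∨ LessDot B A ∨ A = B

/-- `A` and `B` are weakly separated. -/
def WeaklySep (A B : Finset ℕ) : Prop :=
  StronglySep A B ∨ (Splits A B ∧ B.card ≤ A.card) ∨ (Splits B A ∧ A.card ≤ B.card)

/-- a w-collection: members are pairwise weakly separated. -/
def IsWColl (F : Finset (Finset ℕ)) : Prop := ∀ A ∈ F, ∀ B ∈ F, WeaklySep A B

/-- a maximal w-collection in the domain `D`. -/
def IsMaxWColl (D : Set (Finset ℕ)) (F : Finset (Finset ℕ)) : Prop :=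
  ↑F ⊆ D ∧ IsWColl F ∧
    ∀ G : Finset (Finset ℕ), ↑G ⊆ D → IsWColl G → F ⊆ G → F = G

/-- the domain `D` is w-pure: all maximal w-collections in `D` have the same cardinality. -/
def WPure (D : Set (Finset ℕ)) : Prop :=
  ∀ F G : Finset (Finset ℕ), IsMaxWColl D F → IsMaxWColl D G → F.card = G.card

/-- an s-collection: members are pairwise strongly separated. -/
def IsSColl (F : Finset (Finset ℕ)) : Prop := ∀ A ∈ F, ∀ B ∈ F, StronglySep A B

/-- a maximal s-collection in the domain `D`. -/
def IsMaxSColl (D : Set (Finset ℕ)) (F : Finset (Finset ℕ)) : Prop :=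
  ↑F ⊆ D ∧ IsSColl F ∧
    ∀ G : Finset (Finset ℕ), ↑G ⊆ D → IsSColl G → F ⊆ G → F = G

/-- the domain `D` is s-pure: all maximal s-collections in `D` have the same cardinality. -/
def SPure (D : Set (Finset ℕ)) : Prop :=
  ∀ F G : Finset (Finset ℕ), IsMaxSColl D F → IsMaxSColl D G → F.card = G.card

theorem WeaklySep.refl (A : Finset ℕ) : WeaklySep A A := Or.inl (Or.inr (Or.inr rfl))

theorem WeaklySep.symm {A B : Finset ℕ} (h : WeaklySep A B) : WeaklySep B A := by
  rcases h with (h | h | h) | h | h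
  · exact Or.inl (Or.inr (Or.inl h))
  · exact Or.inl (Or.inl h)
  · exact Or.inl (Or.inr (Or.inr h.symm))
  · exact Or.inr (Or.inr h)
  · exact Or.inr (Or.inl h)

/-- A finite domain contains a maximal w-collection. -/
theorem exists_isMaxWColl {D : Set (Finset ℕ)} (hD : D.Finite) :
    ∃ F, IsMaxWColl D F := by
  have hfin : {F : Finset (Finset ℕ) | ↑F ⊆ D ∧ IsWColl F}.Finite := by
    refine hD.toFinset.powerset.finite_toSet.subset fun F hF => ?_
    simpa [Finset.subset_iff, Set.subset_def] using hF.1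
  obtain ⟨F, hF⟩ := hfin.exists_maximal ⟨∅, by simp [IsWColl]⟩
  exact ⟨F, hF.prop.1, hF.prop.2, fun G hGD hG hFG => hF.eq_of_le ⟨hGD, hG⟩ hFG⟩

/-- A maximal w-collection contains every member of the domain that is weakly separated from
all of the domain. -/
theorem IsMaxWColl.mem_of_forall_weaklySep {D : Set (Finset ℕ)} {F : Finset (Finset ℕ)}
    (hF : IsMaxWColl D F) {X : Finset ℕ} (hX : X ∈ D) (hsep : ∀ Y ∈ D, WeaklySep Y X) :
    X ∈ F := by
  obtain ⟨hFD, hFw, hmax⟩ := hF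
  have hcoll : IsWColl (insert X F) := by
    intro A hA B hB
    rcases Finset.mem_insert.1 hA with rfl | hAF <;> rcases Finset.mem_insert.1 hB with rfl | hBF
    · exact .refl _
    · exact (hsep B (hFD hBF)).symm
    · exact hsep A (hFD hAF)
    · exact hFw A hAF B hBF
  rw [hmax (insert X F) (by simp [Set.insert_subset_iff, hX, hFD]) hcoll
    (Finset.subset_insert X F)]
  exact Finset.mem_insert_self X F

/-- In a complementary pair, maximal w-collections of the two domains unite to a maximal
w-collection of the union. -/
theorem IsMaxWColl.union {D D' : Set (Finset ℕ)} (hsep : ∀ X ∈ D, ∀ Y ∈ D', WeaklySep X Y)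
    {F F' : Finset (Finset ℕ)} (hF : IsMaxWColl D F) (hF' : IsMaxWColl D' F') :
    IsMaxWColl (D ∪ D') (F ∪ F') := by
  classical
  obtain ⟨hFD, hFw, hmax⟩ := hF
  obtain ⟨hFD', hFw', hmax'⟩ := hF'
  refine ⟨?_, ?_, fun G hGD hG hsub => hsub.antisymm fun X hX => ?_⟩
  · rw [Finset.coe_union]
    exact Set.union_subset_union hFD hFD'
  · intro A hA B hB
    rcases Finset.mem_union.1 hA with hA | hA <;> rcases Finset.mem_union.1 hB with hB | hB
    · exact hFw A hA B hB
    · exact hsep A (hFD hA) B (hFD' hB)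
    · exact (hsep B (hFD hB) A (hFD' hA)).symm
    · exact hFw' A hA B hB
  · have hcoll : ∀ p : Finset ℕ → Prop, IsWColl (G.filter p) := fun p A hA B hB =>
      hG A (Finset.mem_filter.1 hA).1 B (Finset.mem_filter.1 hB).1
    rcases hGD hX with hXD | hXD
    · refine Finset.mem_union_left _ ?_
      rw [hmax (G.filter (· ∈ D)) (fun Y hY => (Finset.mem_filter.1 hY).2) (hcoll _)
        fun Y hY => Finset.mem_filter.2 ⟨hsub (Finset.mem_union_left _ hY), hFD hY⟩]
      exact Finset.mem_filter.2 ⟨hX, hXD⟩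
    · refine Finset.mem_union_right _ ?_
      rw [hmax' (G.filter (· ∈ D')) (fun Y hY => (Finset.mem_filter.1 hY).2) (hcoll _)
        fun Y hY => Finset.mem_filter.2 ⟨hsub (Finset.mem_union_right _ hY), hFD' hY⟩]
      exact Finset.mem_filter.2 ⟨hX, hXD⟩

/-- The first domain of a complementary pair with w-pure union is w-pure, provided that the second
one is finite. -/
theorem WPure.of_union_left {D D' : Set (Finset ℕ)} (hfin : D'.Finite)
    (hsep : ∀ X ∈ D, ∀ Y ∈ D', WeaklySep X Y) (hpure : WPure (D ∪ D')) : WPure D := by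
  intro F G hF hG
  obtain ⟨F', hF'⟩ := exists_isMaxWColl hfin
  have hinter : ∀ {F G : Finset (Finset ℕ)}, IsMaxWColl D F → IsMaxWColl D G →
      F ∩ F' ⊆ G ∩ F' := by
    intro F G hF hG X hX
    obtain ⟨hXF, hXF'⟩ := Finset.mem_inter.1 hX
    exact Finset.mem_inter.2 ⟨hG.mem_of_forall_weaklySep (hF.1 hXF)
      fun Y hY => hsep Y hY X (hF'.1 hXF'), hXF'⟩
  have hcard := hpure _ _ (hF.union hsep hF') (hG.union hsep hF')
  have hFG := congrArg Finset.card ((hinter hF hG).antisymm (hinter hG hF))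
  have h₁ := Finset.card_union_add_card_inter F F'
  have h₂ := Finset.card_union_add_card_inter G F'
  omega

/-- if every member of `D` is weakly separated from every member of
`D′` and `D ∪ D′` is w-pure, then both `D` and `D′` are w-pure. -/
theorem complementary_pair_w_pure (n : ℕ) (hn : 1 ≤ n) (D D' : Set (Finset ℕ))
    (hD : ∀ X ∈ D, X ⊆ Finset.Icc 1 n) (hD' : ∀ Y ∈ D', Y ⊆ Finset.Icc 1 n)
    (hsep : ∀ X ∈ D, ∀ Y ∈ D', WeaklySep X Y)
    (hpure : WPure (D ∪ D')) :
    WPure D ∧ WPure D' := by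
  have hfin : ∀ E : Set (Finset ℕ), (∀ X ∈ E, X ⊆ Finset.Icc 1 n) → E.Finite := fun E hE =>
    (Finset.Icc 1 n).powerset.finite_toSet.subset fun X hX =>
      Finset.mem_coe.2 (Finset.mem_powerset.2 (hE X hX))
  exact ⟨hpure.of_union_left (hfin D' hD') hsep,
    WPure.of_union_left (hfin D hD) (fun X hX Y hY => (hsep Y hY X hX).symm)
      (Set.union_comm D D' ▸ hpure)⟩
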